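/- Let ψ(x₁,…,x_n) be a Peano formula whose set of monomials is Mon_ψ = {M₁,…,M_m} and whose set of constants is Const_ψ = {b₁,…,b_k}, let (c₁,…,c_n) ∈ ℕ^n be an assignment for ψ, and let r₁, r₂ ∈ ℚ with r₁ ≥ r₂ > 0. Then there is a combination function comb, computed by a feedforward neural network with ReLU activations and rational weights, such that for an input vector x containing the values r₁·M_i(c₁,…,c_n) for all i ≤ m, the values r₁·b_j for all j ≤ k, and the value r₂, and for arbitrary vectors y₁, y₂, y₃ (representing results of local and global aggregations): the designated output coordinate of comb(x, y₁, y₂, y₃) equals r₂ if (c₁,…,c_n) ⊨ ψ, and equals 0 if (c₁,…,c_n) ⊭ ψ. -/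

import Mathlib

namespace PMLMPNN

/-- Modalities of Peano modal logic. -/
inductive Modality where
  | id | ein | eout | top
deriving DecidableEq

/-- A normalised integer inequality `∑ i, a i * ∏ (mon i) ≤ b`. -/
structure PeanoIneq (m : ℕ) where
  K : ℕ
  a : Fin K → ℤ
  mon : Fin K → List (Fin m)
  b : ℤ

/-- Value of a monomial (a list of variables) under an assignment. -/
def monValZ {m : ℕ} (c : Fin m → ℕ) (l : List (Fin m)) : ℤ :=
  (l.map (fun j => (c j : ℤ))).prod

def PeanoIneq.sat {m : ℕ} (t : PeanoIneq m) (c : Fin m → ℕ) : Bool :=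
  decide ((∑ i, t.a i * monValZ c (t.mon i)) ≤ t.b)

def PeanoIneq.deg {m : ℕ} (t : PeanoIneq m) : ℕ :=
  Finset.univ.sup (fun i => (t.mon i).length)

/-- Peano formulas: Boolean combinations of normalised inequalities. -/
inductive PeanoFormula (m : ℕ) where
  | ineq : PeanoIneq m → PeanoFormula m
  | not : PeanoFormula m → PeanoFormula m
  | and : PeanoFormula m → PeanoFormula m → PeanoFormula m

def PeanoFormula.sat {m : ℕ} (c : Fin m → ℕ) : PeanoFormula m → Bool
  | .ineq t => t.sat c
  | .not ψ => ! ψ.sat c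
  | .and ψ₁ ψ₂ => ψ₁.sat c && ψ₂.sat c

def PeanoFormula.deg {m : ℕ} : PeanoFormula m → ℕ
  | .ineq t => t.deg
  | .not ψ => ψ.deg
  | .and ψ₁ ψ₂ => max ψ₁.deg ψ₂.deg

/-- A term is homogeneous if it has no constant part and all its monomials
have the same degree. -/
def PeanoIneq.Homog {m : ℕ} (t : PeanoIneq m) : Prop :=
  t.b = 0 ∧ ∀ i, (t.mon i).length = t.deg

def PeanoFormula.Homog {m : ℕ} : PeanoFormula m → Prop
  | .ineq t => t.Homog
  | .not ψ => ψ.Homog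
  | .and ψ₁ ψ₂ => ψ₁.Homog ∧ ψ₂.Homog

/-- The set of monomials occurring in a Peano formula. -/
def PeanoFormula.mons {m : ℕ} : PeanoFormula m → Finset (List (Fin m))
  | .ineq t => Finset.univ.image t.mon
  | .not ψ => ψ.mons
  | .and ψ₁ ψ₂ => ψ₁.mons ∪ ψ₂.mons

/-- The set of constants occurring in a Peano formula. -/
def PeanoFormula.consts {m : ℕ} : PeanoFormula m → Finset ℤ
  | .ineq t => {t.b}
  | .not ψ => ψ.consts
  | .and ψ₁ ψ₂ => ψ₁.consts ∪ ψ₂.consts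

/-- PML formulas over `k` colours (propositions). -/
inductive PML (k : ℕ) where
  | prop : Fin k → PML k
  | not : PML k → PML k
  | and : PML k → PML k → PML k
  | modal : (m : ℕ) → (Fin m → Modality) → PeanoFormula m → (Fin m → PML k) → PML k

def PML.md {k : ℕ} : PML k → ℕ
  | .prop _ => 0
  | .not φ => φ.md
  | .and φ₁ φ₂ => max φ₁.md φ₂.md
  | .modal _ _ _ φs => 1 + Finset.univ.sup (fun i => (φs i).md)

def PML.deg {k : ℕ} : PML k → ℕ
  | .prop _ => 0
  | .not φ => φ.deg
  | .and φ₁ φ₂ => max φ₁.deg φ₂.deg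
  | .modal _ _ ψ φs => max ψ.deg (Finset.univ.sup (fun i => (φs i).deg))

def PML.onlyTop {k : ℕ} : PML k → Prop
  | .prop _ => True
  | .not φ => φ.onlyTop
  | .and φ₁ φ₂ => φ₁.onlyTop ∧ φ₂.onlyTop
  | .modal _ π _ φs => (∀ i, π i = Modality.top) ∧ (∀ i, (φs i).onlyTop)

def PML.onlyE {k : ℕ} : PML k → Prop
  | .prop _ => True
  | .not φ => φ.onlyE
  | .and φ₁ φ₂ => φ₁.onlyE ∧ φ₂.onlyE
  | .modal _ π _ φs => (∀ i, π i = Modality.ein ∨ π i = Modality.eout) ∧ (∀ i, (φs i).onlyE)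

/-- Propositional formulas: no modal subformula at all. -/
def PML.NoModal {k : ℕ} : PML k → Prop
  | .prop _ => True
  | .not φ => φ.NoModal
  | .and φ₁ φ₂ => φ₁.NoModal ∧ φ₂.NoModal
  | .modal _ _ _ _ => False

/-- Subformula relation. -/
inductive PML.Sub {k : ℕ} : PML k → PML k → Prop where
  | refl (φ : PML k) : PML.Sub φ φ
  | not {χ φ : PML k} : PML.Sub χ φ → PML.Sub χ (.not φ)
  | and_left {χ φ₁ φ₂ : PML k} : PML.Sub χ φ₁ → PML.Sub χ (.and φ₁ φ₂)
  | and_right {χ φ₁ φ₂ : PML k} : PML.Sub χ φ₂ → PML.Sub χ (.and φ₁ φ₂)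
  | modal {χ : PML k} {m : ℕ} {π : Fin m → Modality} {ψ : PeanoFormula m}
      {φs : Fin m → PML k} (i : Fin m) :
      PML.Sub χ (φs i) → PML.Sub χ (.modal m π ψ φs)

/-- Finite directed node-labelled graphs with `k` colours; labels in `{0,1}^k`
are represented by Boolean vectors. -/
structure Graph (k : ℕ) where
  n : ℕ
  E : Finset (Fin n × Fin n)
  L : Fin n → Fin k → Bool

def Graph.neighIn {k : ℕ} (G : Graph k) (v : Fin G.n) : Finset (Fin G.n) :=
  Finset.univ.filter (fun u => (u, v) ∈ G.E)

def Graph.neighOut {k : ℕ} (G : Graph k) (v : Fin G.n) : Finset (Fin G.n) :=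
  Finset.univ.filter (fun u => (v, u) ∈ G.E)

def Graph.Regular {k : ℕ} (G : Graph k) : Prop :=
  ∀ u v : Fin G.n,
    (G.neighIn u).card = (G.neighIn v).card ∧ (G.neighOut u).card = (G.neighOut v).card

/-- `v` is marked by colour `p`. -/
def Graph.MarkedBy {k : ℕ} (G : Graph k) (v : Fin G.n) (p : Fin k) : Prop :=
  ∀ u : Fin G.n, G.L u p = true ↔ u = v

/-- `v` is strongly marked by colour `p`: marked and `v ∈ neigh(v)`. -/
def Graph.StronglyMarkedBy {k : ℕ} (G : Graph k) (v : Fin G.n) (p : Fin k) : Prop :=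
  G.MarkedBy v p ∧ (v, v) ∈ G.E

def Graph.modSem {k : ℕ} (G : Graph k) (v : Fin G.n) : Modality → Finset (Fin G.n)
  | .id => {v}
  | .ein => G.neighIn v
  | .eout => G.neighOut v
  | .top => Finset.univ

/-- Satisfaction of PML formulas on pointed graphs. -/
def PML.sat {k : ℕ} (G : Graph k) : PML k → Fin G.n → Bool
  | .prop i, v => G.L v i
  | .not φ, v => ! PML.sat G φ v
  | .and φ₁ φ₂, v => PML.sat G φ₁ v && PML.sat G φ₂ v
  | .modal _ π ψ φs, v =>
      ψ.sat (fun i => ((G.modSem v (π i)).filter (fun u => PML.sat G (φs i) u = true)).card)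

/-- Feedforward neural networks with ReLU activations and rational weights. -/
inductive FNN : ℕ → ℕ → Type where
  | layer {din dout : ℕ} (w : Fin dout → Fin din → ℚ) (b : Fin dout → ℚ) : FNN din dout
  | comp {d₁ d₂ d₃ : ℕ} : FNN d₁ d₂ → FNN d₂ d₃ → FNN d₁ d₃

def FNN.eval : {din dout : ℕ} → FNN din dout → (Fin din → ℚ) → Fin dout → ℚ
  | _, _, .layer w b, x => fun j => max 0 (b j + ∑ i, w j i * x i)
  | _, _, .comp f g, x => g.eval (f.eval x)

/-- Aggregation functions on finite multisets of vectors. -/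
inductive Agg where
  | mean | sum | max
deriving DecidableEq

noncomputable def Agg.eval {d : ℕ} : Agg → Multiset (Fin d → ℚ) → Fin d → ℚ
  | .mean, s => fun i => (s.map (fun f => f i)).sum / (Multiset.card s : ℚ)
  | .sum, s => fun i => (s.map (fun f => f i)).sum
  | .max, s => fun i => ((s.map (fun f => f i)).toList).foldr Max.max 0

/-- One MPNN layer: a combination function (an FNN applied to the previous
state and the three aggregated messages) together with the choice of the two
local and the global aggregation functions. -/
structure MPNNLayer (din dout : ℕ) where
  comb : FNN (din + din + din + din) dout
  locIn : Agg
  locOut : Agg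
  glob : Agg

noncomputable def MPNNLayer.step {k din dout : ℕ} (l : MPNNLayer din dout) (G : Graph k)
    (x : Fin G.n → Fin din → ℚ) : Fin G.n → Fin dout → ℚ :=
  fun v => l.comb.eval
    (Fin.append (Fin.append (Fin.append (x v)
      (l.locIn.eval ((G.neighIn v).val.map x)))
      (l.locOut.eval ((G.neighOut v).val.map x)))
      (l.glob.eval ((Finset.univ : Finset (Fin G.n)).val.map x)))

/-- A message passing neural network: `L` layers with state dimensions
`dims 0, dims 1, …, dims L`. -/
structure MPNN where
  L : ℕ
  dims : ℕ → ℕ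
  layers : (i : ℕ) → MPNNLayer (dims i) (dims (i + 1))

/-- Initial state: the label of the node (padded with zeros if needed). -/
def Graph.init {k : ℕ} (G : Graph k) (d : ℕ) (v : Fin G.n) : Fin d → ℚ :=
  fun j => if h : (j : ℕ) < k then (if G.L v ⟨j, h⟩ then 1 else 0) else 0

/-- The state `x_v^{(i)}` computed by `M` on `G`. -/
noncomputable def MPNN.state {k : ℕ} (M : MPNN) (G : Graph k) : (i : ℕ) → Fin G.n → Fin (M.dims i) → ℚ
  | 0 => fun v => G.init (M.dims 0) v
  | i + 1 => (M.layers i).step G (M.state G i)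

/-- Last coordinate of a vector. -/
def lastVal {d : ℕ} (x : Fin d → ℚ) : ℚ :=
  if h : 0 < d then x ⟨d - 1, Nat.sub_lt h Nat.one_pos⟩ else 0

/-- The output `M(G,v)_⊥`: the last coordinate of the final state. -/
noncomputable def MPNN.out {k : ℕ} (M : MPNN) (G : Graph k) (v : Fin G.n) : ℚ :=
  lastVal (M.state G M.L v)

/-- All aggregations of `M` belong to the set `A`. -/
def MPNN.UsesAggs (M : MPNN) (A : Set Agg) : Prop :=
  ∀ i < M.L, (M.layers i).locIn ∈ A ∧ (M.layers i).locOut ∈ A ∧ (M.layers i).glob ∈ A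

/-- `M` belongs to the class `M_mean`. -/
def MPNN.IsMean (M : MPNN) : Prop := M.UsesAggs {Agg.mean}

/-- `M` recognises `φ` over the class `Cls` with certainty `c(|V|)`. -/
def Recognises {k : ℕ} (M : MPNN) (φ : PML k)
    (Cls : (G : Graph k) → Fin G.n → Prop) (c : ℕ → ℚ) : Prop :=
  ∀ (G : Graph k) (v : Fin G.n), Cls G v →
    (PML.sat G φ v = true → M.out G v = c G.n) ∧
    (PML.sat G φ v = false → M.out G v = 0)

end PMLMPNN
namespace PMLMPNN

/-- `f` is an affine function of the outputs of the network `N`. -/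
def Aff {d e : ℕ} (N : FNN d e) (f : (Fin d → ℚ) → ℚ) : Prop :=
  ∃ (w : Fin e → ℚ) (b : ℚ), ∀ x, f x = b + ∑ i, w i * N.eval x i

theorem FNN.eval_nonneg {d e : ℕ} (N : FNN d e) : ∀ (x : Fin d → ℚ) (i : Fin e), 0 ≤ N.eval x i := by
  induction N with
  | layer w b => intro x i; simp [FNN.eval]
  | comp f g _ ihg => intro x i; simp only [FNN.eval]; exact ihg _ _

theorem Aff.add {d e : ℕ} {N : FNN d e} {f g : (Fin d → ℚ) → ℚ} (hf : Aff N f) (hg : Aff N g) :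
    Aff N (fun x => f x + g x) := by
  obtain ⟨w, b, h⟩ := hf
  obtain ⟨w', b', h'⟩ := hg
  refine ⟨fun i => w i + w' i, b + b', fun x => ?_⟩
  simp only [h, h', add_mul, Finset.sum_add_distrib]
  ring

theorem Aff.smul {d e : ℕ} {N : FNN d e} {f : (Fin d → ℚ) → ℚ} (a : ℚ) (hf : Aff N f) :
    Aff N (fun x => a * f x) := by
  obtain ⟨w, b, h⟩ := hf
  refine ⟨fun i => a * w i, a * b, fun x => ?_⟩
  simp only [h, mul_assoc, ← Finset.mul_sum]
  ring

theorem Aff.sub {d e : ℕ} {N : FNN d e} {f g : (Fin d → ℚ) → ℚ} (hf : Aff N f) (hg : Aff N g) :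
    Aff N (fun x => f x - g x) := by
  have := hf.add (hg.smul (-1))
  simpa [sub_eq_add_neg] using this

theorem Aff.sum {d e : ℕ} {N : FNN d e} {K : ℕ} (f : Fin K → (Fin d → ℚ) → ℚ)
    (hf : ∀ i, Aff N (f i)) : Aff N (fun x => ∑ i, f i x) := by
  choose w b h using hf
  refine ⟨fun j => ∑ i, w i j, ∑ i, b i, fun x => ?_⟩
  simp only [h, Finset.sum_add_distrib, Finset.sum_mul]
  rw [Finset.sum_comm]

theorem Aff.coord {d e : ℕ} (N : FNN d e) (j : Fin e) : Aff N (fun x => N.eval x j) :=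
  ⟨fun i => if i = j then 1 else 0, 0, fun x => by simp⟩

/-- Adding one ReLU neuron, keeping everything computed so far. -/
theorem Aff.extend {d e : ℕ} (N : FNN d e) {f : (Fin d → ℚ) → ℚ} (hf : Aff N f) :
    ∃ N' : FNN d (e + 1), (∀ g, Aff N g → Aff N' g) ∧ Aff N' (fun x => max 0 (f x)) := by
  obtain ⟨w, b, h⟩ := hf
  let N' : FNN d (e + 1) := .comp N (.layer
    (Fin.snoc (α := fun _ => Fin e → ℚ) (fun i j => if j = i then 1 else 0) w)
    (Fin.snoc (α := fun _ => ℚ) (fun _ => 0) b))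
  have hc : ∀ x i, N'.eval x (Fin.castSucc i) = N.eval x i := by
    intro x i
    simp [N', FNN.eval, FNN.eval_nonneg]
  have hl : ∀ x, N'.eval x (Fin.last e) = max 0 (f x) := by
    intro x
    simp [N', FNN.eval, h]
  refine ⟨N', ?_, ?_⟩
  · rintro g ⟨u, c, hg⟩
    refine ⟨Fin.snoc (α := fun _ => ℚ) u 0, c, fun x => ?_⟩
    rw [Fin.sum_univ_castSucc]
    simp [hc, hg]
  · have := Aff.coord N' (Fin.last e)
    simpa only [hl] using this

/-- A first layer from whose outputs all inputs can be recovered. -/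
theorem Aff.base (d : ℕ) : ∃ N : FNN d (d + d), ∀ i, Aff N (fun x => x i) := by
  let N : FNN d (d + d) := .layer
    (Fin.append (fun i j => if j = i then 1 else 0) (fun i j => if j = i then -1 else 0)) (fun _ => 0)
  refine ⟨N, fun i => ?_⟩
  have h := (Aff.coord N (Fin.castAdd d i)).sub (Aff.coord N (Fin.natAdd d i))
  have h1 : ∀ x : Fin d → ℚ,
      N.eval x (Fin.castAdd d i) - N.eval x (Fin.natAdd d i) = x i := by
    intro x
    simp only [N, FNN.eval, Fin.append_left, Fin.append_right]
    simp
    rcases le_total 0 (x i) with h | h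
    · rw [max_eq_right h, max_eq_left (by linarith)]; ring
    · rw [max_eq_left h, max_eq_right (by linarith)]; ring
  simpa only [h1] using h

/-- The input vector `x` encodes the assignment `c` and the scalars `r₁`, `r₂`. -/
def Encodes {n d m k : ℕ} (Ms : Fin m → List (Fin n)) (bs : Fin k → ℤ)
    (pM : Fin m → Fin d) (pB : Fin k → Fin d) (pR : Fin d)
    (x : Fin d → ℚ) (c : Fin n → ℕ) (r₁ r₂ : ℚ) : Prop :=
  r₂ ≤ r₁ ∧ 0 < r₂ ∧ (∀ i, x (pM i) = r₁ * ((monValZ c (Ms i) : ℤ) : ℚ)) ∧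
    (∀ j, x (pB j) = r₁ * ((bs j : ℤ) : ℚ)) ∧ x pR = r₂

theorem exists_formula_net {n d m k : ℕ} (Ms : Fin m → List (Fin n)) (bs : Fin k → ℤ)
    (pM : Fin m → Fin d) (pB : Fin k → Fin d) (pR : Fin d) (ψ : PeanoFormula n)
    (hM : ψ.mons ⊆ Finset.univ.image Ms) (hB : ψ.consts ⊆ Finset.univ.image bs) :
    ∀ (e : ℕ) (N : FNN d e), (∀ i, Aff N (fun x => x i)) →
    ∃ (e' : ℕ) (N' : FNN d e') (f : (Fin d → ℚ) → ℚ),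
      (∀ g, Aff N g → Aff N' g) ∧ Aff N' f ∧
      ∀ x c r₁ r₂, Encodes Ms bs pM pB pR x c r₁ r₂ →
        f x = if ψ.sat c = true then r₂ else 0 := by
  induction ψ with
  | ineq t =>
    intro e N hN
    have hm : ∀ i, ∃ l, Ms l = t.mon i := by
      intro i
      have : t.mon i ∈ Finset.univ.image Ms := hM (by simp [PeanoFormula.mons])
      simpa using this
    have hb : ∃ j, bs j = t.b := by
      have : t.b ∈ Finset.univ.image bs := hB (by simp [PeanoFormula.consts])
      simpa using this
    choose l hl using hm
    obtain ⟨j, hj⟩ := hb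
    have a1 : Aff N (fun x => (∑ i, (t.a i : ℚ) * x (pM (l i))) - x (pB j)) :=
      (Aff.sum (fun i x => (t.a i : ℚ) * x (pM (l i))) (fun i => (hN _).smul _)).sub (hN _)
    obtain ⟨N₁, k₁, a₁⟩ := a1.extend
    obtain ⟨N₂, k₂, a₂⟩ := ((k₁ _ (hN pR)).sub a₁).extend
    refine ⟨_, N₂, _, fun g hg => k₂ g (k₁ g hg), a₂, ?_⟩
    rintro x c r₁ r₂ ⟨h₁, h₂, hxM, hxB, hxR⟩
    have hs : (∑ i, (t.a i : ℚ) * x (pM (l i))) - x (pB j)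
        = r₁ * (((∑ i, t.a i * monValZ c (t.mon i)) - t.b : ℤ) : ℚ) := by
      simp only [hxM, hxB, hl, hj]
      push_cast
      rw [mul_sub, Finset.mul_sum]
      congr 1
      exact Finset.sum_congr rfl fun i _ => by ring
    simp only [hs, hxR, PeanoFormula.sat, PeanoIneq.sat, decide_eq_true_eq]
    split_ifs with hc
    · have : (((∑ i, t.a i * monValZ c (t.mon i)) - t.b : ℤ) : ℚ) ≤ 0 := by
        exact_mod_cast sub_nonpos.mpr hc
      rw [max_eq_left (mul_nonpos_of_nonneg_of_nonpos (by linarith) this), sub_zero,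
        max_eq_right h₂.le]
    · have h1 : (1 : ℚ) ≤ (((∑ i, t.a i * monValZ c (t.mon i)) - t.b : ℤ) : ℚ) := by
        have : 1 ≤ (∑ i, t.a i * monValZ c (t.mon i)) - t.b := by omega
        exact_mod_cast this
      have h2 : r₁ ≤ r₁ * (((∑ i, t.a i * monValZ c (t.mon i)) - t.b : ℤ) : ℚ) :=
        le_mul_of_one_le_right (by linarith) h1
      apply max_eq_left
      have := le_max_right 0 (r₁ * (((∑ i, t.a i * monValZ c (t.mon i)) - t.b : ℤ) : ℚ))
      linarith
  | not ψ ih =>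
    intro e N hN
    obtain ⟨e₁, N₁, f, k₁, a₁, hf⟩ := ih hM hB e N hN
    obtain ⟨N₂, k₂, a₂⟩ := ((k₁ _ (hN pR)).sub a₁).extend
    refine ⟨_, N₂, _, fun g hg => k₂ g (k₁ g hg), a₂, ?_⟩
    intro x c r₁ r₂ h
    have hv := hf x c r₁ r₂ h
    obtain ⟨h₁, h₂, hxM, hxB, hxR⟩ := h
    simp only [hv, hxR, PeanoFormula.sat]
    rcases Bool.eq_false_or_eq_true (ψ.sat c) with e | e <;> simp [e, h₂.le]
  | and ψ₁ ψ₂ ih₁ ih₂ =>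
    intro e N hN
    simp only [PeanoFormula.mons, PeanoFormula.consts, Finset.union_subset_iff] at hM hB
    obtain ⟨e₁, N₁, f₁, k₁, a₁, hf₁⟩ := ih₁ hM.1 hB.1 e N hN
    obtain ⟨e₂, N₂, f₂, k₂, a₂, hf₂⟩ := ih₂ hM.2 hB.2 e₁ N₁ (fun i => k₁ _ (hN i))
    obtain ⟨N₃, k₃, a₃⟩ := (((k₂ _ a₁).add a₂).sub (k₂ _ (k₁ _ (hN pR)))).extend
    refine ⟨_, N₃, _, fun g hg => k₃ g (k₂ g (k₁ g hg)), a₃, ?_⟩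
    intro x c r₁ r₂ h
    have hv₁ := hf₁ x c r₁ r₂ h
    have hv₂ := hf₂ x c r₁ r₂ h
    obtain ⟨h₁, h₂, hxM, hxB, hxR⟩ := h
    simp only [hv₁, hv₂, hxR, PeanoFormula.sat]
    rcases Bool.eq_false_or_eq_true (ψ₁.sat c) with e | e <;>
      rcases Bool.eq_false_or_eq_true (ψ₂.sat c) with e' | e' <;> simp [e, e', h₂.le]

/-- Uniform version: one network works for all assignments `c` and all `r₁ ≥ r₂ > 0`. -/
theorem exists_uniform_net {n d m k : ℕ} (Ms : Fin m → List (Fin n)) (bs : Fin k → ℤ)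
    (pM : Fin m → Fin d) (pB : Fin k → Fin d) (pR : Fin d) (ψ : PeanoFormula n)
    (hM : ψ.mons ⊆ Finset.univ.image Ms) (hB : ψ.consts ⊆ Finset.univ.image bs) :
    ∃ N : FNN d 1, ∀ x c r₁ r₂, Encodes Ms bs pM pB pR x c r₁ r₂ →
        N.eval x 0 = if ψ.sat c = true then r₂ else 0 := by
  obtain ⟨N₀, h₀⟩ := Aff.base d
  obtain ⟨e, N, f, -, ⟨w, b, hw⟩, hf⟩ := exists_formula_net Ms bs pM pB pR ψ hM hB _ N₀ h₀
  refine ⟨.comp N (.layer (fun _ => w) (fun _ => b)), fun x c r₁ r₂ h => ?_⟩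
  have hv := hf x c r₁ r₂ h
  simp only [FNN.eval]
  rw [← hw, hv]
  apply max_eq_right
  split_ifs
  · exact h.2.1.le
  · exact le_rfl

/-- given a Peano formula `ψ`, an assignment `c`, rationals
`r₁ ≥ r₂ > 0`, and enumerations `Ms` of its monomials and `bs` of its
constants, there is a ReLU FNN combination function that, on an input vector
containing the values `r₁·M_i(c)` for all monomials, `r₁·b_j` for all
constants, and `r₂` (together with arbitrary aggregation results
`y₁, y₂, y₃`), outputs at a designated coordinate `r₂` if `c ⊨ ψ` and `0`
otherwise. -/
theorem statement11 (n : ℕ) (ψ : PeanoFormula n) (c : Fin n → ℕ) (r₁ r₂ : ℚ)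
    (h₁ : r₂ ≤ r₁) (h₂ : 0 < r₂)
    (m k : ℕ) (Ms : Fin m → List (Fin n)) (bs : Fin k → ℤ)
    (hMs : Finset.univ.image Ms = ψ.mons)
    (hbs : Finset.univ.image bs = ψ.consts)
    (dy : ℕ) :
    ∃ (dout : ℕ) (N : FNN (m + k + 1 + dy + dy + dy) dout) (j : Fin dout),
      ∀ y₁ y₂ y₃ : Fin dy → ℚ,
        N.eval (Fin.append (Fin.append (Fin.append
            (Fin.append (Fin.append
              (fun i => r₁ * ((monValZ c (Ms i) : ℤ) : ℚ))
              (fun j' => r₁ * ((bs j' : ℤ) : ℚ)))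
              (fun _ : Fin 1 => r₂)) y₁) y₂) y₃) j =
          (if ψ.sat c = true then r₂ else 0) := by
  obtain ⟨N, hN⟩ := exists_uniform_net (d := m + k + 1 + dy + dy + dy) Ms bs
    (fun i => Fin.castAdd dy (Fin.castAdd dy (Fin.castAdd dy (Fin.castAdd 1 (Fin.castAdd k i)))))
    (fun i => Fin.castAdd dy (Fin.castAdd dy (Fin.castAdd dy (Fin.castAdd 1 (Fin.natAdd m i)))))
    (Fin.castAdd dy (Fin.castAdd dy (Fin.castAdd dy (Fin.natAdd (m + k) 0))))
    ψ hMs.ge hbs.ge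
  refine ⟨1, N, 0, fun y₁ y₂ y₃ => hN _ c r₁ r₂ ⟨h₁, h₂, fun i => ?_, fun i => ?_, ?_⟩⟩
  all_goals simp only [Fin.append_left, Fin.append_right]

end PMLMPNN
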